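/- arXiv:1304.7274 — 2 statements merged into one kernel-verified Lean document; each statement's English description precedes it below -/
import Mathlib

section
/- Let $m, n, q$ be positive integers. The map sending a staircase $m \times n$ matrix $(p_{i,j})$ of non-negative integers with all column sums strictly smaller than $q$ to the tuple $\big((q-1) - \sum_{i} p_{i,1}, \dots, (q-1) - \sum_{i} p_{i,n}, \sum_{j} p_{2,j}, \dots, \sum_{j} p_{m,j}\big)$ is a bijection onto the set of $(m+n-1)$-tuples of non-negative integers that sum up to at most $n(q-1)$ and whose first $n$ entries are strictly smaller than $q$. -/
/-- An `m × n` matrix of non-negative integers is staircase if whenever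
`p i j > 0`, `i' < i` and `j < j'`, then `p i' j' = 0`. -/
def IsStaircase {m n : ℕ} (p : Fin m → Fin n → ℕ) : Prop :=
  ∀ i i' : Fin m, ∀ j j' : Fin n, 0 < p i j → i' < i → j < j' → p i' j' = 0

/-- The matrix given by the north-west corner rule: the `(i, j)` entry is the length of the
intersection of the intervals `[R i, R (i + 1))` and `[C j, C (j + 1))`. -/
def cornerMatrix (R C : ℕ → ℕ) (i j : ℕ) : ℕ :=
  min (R (i + 1)) (C (j + 1)) - max (R i) (C j)

theorem cornerMatrix_comm (R C : ℕ → ℕ) (i j : ℕ) :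
    cornerMatrix R C i j = cornerMatrix C R j i := by
  simp only [cornerMatrix, min_comm, max_comm]

theorem sum_range_cornerMatrix {R C : ℕ → ℕ} (hR : Monotone R) (hC : Monotone C) (hC0 : C 0 = 0)
    (i b : ℕ) :
    ∑ j ∈ Finset.range b, cornerMatrix R C i j = min (R (i + 1)) (C b) - min (R i) (C b) := by
  induction b with
  | zero => simp [hC0]
  | succ b ih =>
    have h1 := hC (Nat.le_succ b)
    have h2 := hR (Nat.le_succ i)
    rw [Finset.sum_range_succ, ih, cornerMatrix]
    simp only [Nat.succ_eq_add_one] at h1 h2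
    omega

theorem cornerMatrix_eq_zero {R C : ℕ → ℕ} (hR : Monotone R) (hC : Monotone C) {i i' j j' : ℕ}
    (h : 0 < cornerMatrix R C i j) (hi : i' < i) (hj : j < j') : cornerMatrix R C i' j' = 0 := by
  have h1 : R (i' + 1) ≤ R i := hR hi
  have h2 : C (j + 1) ≤ C j' := hC hj
  simp only [cornerMatrix] at h ⊢
  omega

/-- Extension of a finite sequence by zero. -/
def zeroExtend {n : ℕ} (c : Fin n → ℕ) (j : ℕ) : ℕ :=
  if h : j < n then c ⟨j, h⟩ else 0

@[simp]
theorem zeroExtend_coe {n : ℕ} (c : Fin n → ℕ) (j : Fin n) : zeroExtend c j = c j := by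
  simp [zeroExtend]

theorem sum_range_zeroExtend {n : ℕ} (c : Fin n → ℕ) :
    ∑ j ∈ Finset.range n, zeroExtend c j = ∑ j, c j := by
  simp [← Fin.sum_univ_eq_sum_range]

theorem monotone_sum_range (f : ℕ → ℕ) : Monotone fun a => ∑ i ∈ Finset.range a, f i :=
  monotone_nat_of_le_succ fun a => by simp [Finset.sum_range_succ]

theorem exists_isStaircase {m n : ℕ} (r : Fin m → ℕ) (c : Fin n → ℕ)
    (h : ∑ i, r i = ∑ j, c j) :
    ∃ p : Fin m → Fin n → ℕ,
      IsStaircase p ∧ (∀ i, ∑ j, p i j = r i) ∧ ∀ j, ∑ i, p i j = c j := by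
  set R : ℕ → ℕ := fun a => ∑ i ∈ Finset.range a, zeroExtend r i with hRdef
  set C : ℕ → ℕ := fun b => ∑ j ∈ Finset.range b, zeroExtend c j with hCdef
  have hR : Monotone R := monotone_sum_range _
  have hC : Monotone C := monotone_sum_range _
  have hRC : R m = C n := by simpa only [hRdef, hCdef, sum_range_zeroExtend] using h
  refine ⟨fun i j => cornerMatrix R C i j, ?_, fun i => ?_, fun j => ?_⟩
  · exact fun i i' j j' hp hi hj => cornerMatrix_eq_zero hR hC hp hi hj
  · rw [Fin.sum_univ_eq_sum_range (fun j => cornerMatrix R C i j),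
      sum_range_cornerMatrix hR hC (by simp [hCdef])]
    have h1 : R (i + 1) ≤ R m := hR i.isLt
    have h2 : R (i + 1) = R i + r i := by simp [hRdef, Finset.sum_range_succ]
    omega
  · simp_rw [cornerMatrix_comm R C]
    rw [Fin.sum_univ_eq_sum_range (fun i => cornerMatrix C R j i),
      sum_range_cornerMatrix hC hR (by simp [hRdef])]
    have h1 : C (j + 1) ≤ C n := hC j.isLt
    have h2 : C (j + 1) = C j + c j := by simp [hCdef, Finset.sum_range_succ]
    omega

/-- Every leading block of a staircase matrix has as its sum the smaller of the corresponding
partial sums of the row sums and of the column sums. -/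
theorem IsStaircase.sum_block_eq_min {m n : ℕ} {p : Fin m → Fin n → ℕ} (hp : IsStaircase p)
    (a b : ℕ) :
    ∑ i with i.val < a, ∑ j with j.val < b, p i j =
      min (∑ i with i.val < a, ∑ j, p i j) (∑ j with j.val < b, ∑ i, p i j) := by
  have hrow : ∑ i with i.val < a, ∑ j, p i j = ∑ i with i.val < a, ∑ j with j.val < b, p i j +
      ∑ i with i.val < a, ∑ j with ¬ j.val < b, p i j := by
    rw [← Finset.sum_add_distrib]
    exact Finset.sum_congr rfl fun i _ => (Finset.sum_filter_add_sum_filter_not _ _ _).symm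
  have hcol : ∑ j with j.val < b, ∑ i, p i j = ∑ i with i.val < a, ∑ j with j.val < b, p i j +
      ∑ j with j.val < b, ∑ i with ¬ i.val < a, p i j := by
    rw [Finset.sum_comm (s := Finset.univ.filter fun i : Fin m => i.val < a),
      ← Finset.sum_add_distrib]
    exact Finset.sum_congr rfl fun j _ => (Finset.sum_filter_add_sum_filter_not _ _ _).symm
  have hzero : ∑ i with i.val < a, ∑ j with ¬ j.val < b, p i j = 0 ∨
      ∑ j with j.val < b, ∑ i with ¬ i.val < a, p i j = 0 := by
    by_contra! hne
    obtain ⟨⟨i', hi', hne'⟩, ⟨j, hj, hne''⟩⟩ :=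
      And.intro (Finset.exists_ne_zero_of_sum_ne_zero hne.1)
        (Finset.exists_ne_zero_of_sum_ne_zero hne.2)
    obtain ⟨j', hj', hpos'⟩ := Finset.exists_ne_zero_of_sum_ne_zero hne'
    obtain ⟨i, hi, hpos⟩ := Finset.exists_ne_zero_of_sum_ne_zero hne''
    simp only [Finset.mem_filter, Finset.mem_univ, true_and] at hi hi' hj hj'
    exact hpos' (hp i i' j j' (Nat.pos_of_ne_zero hpos) (by omega) (by omega))
  omega

theorem sum_val_lt_succ {n : ℕ} (c : Fin n → ℕ) (k : Fin n) :
    ∑ j with j.val < k.val + 1, c j = ∑ j with j.val < k.val, c j + c k := by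
  have h : (Finset.univ.filter fun j : Fin n => j.val < k.val + 1) =
      insert k (Finset.univ.filter fun j : Fin n => j.val < k.val) := by
    ext j
    simp only [Finset.mem_filter, Finset.mem_univ, true_and, Finset.mem_insert, Fin.ext_iff]
    omega
  rw [h, Finset.sum_insert (by simp), add_comm]

theorem IsStaircase.eq_of_sums_eq {m n : ℕ} {p p' : Fin m → Fin n → ℕ} (hp : IsStaircase p)
    (hp' : IsStaircase p') (hrow : ∀ i, ∑ j, p i j = ∑ j, p' i j)
    (hcol : ∀ j, ∑ i, p i j = ∑ i, p' i j) : p = p' := by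
  have hblock (a b : ℕ) : ∑ i with i.val < a, ∑ j with j.val < b, p i j =
      ∑ i with i.val < a, ∑ j with j.val < b, p' i j := by
    rw [hp.sum_block_eq_min, hp'.sum_block_eq_min]
    simp only [hrow, hcol]
  have hrowblock (i : Fin m) (b : ℕ) :
      ∑ j with j.val < b, p i j = ∑ j with j.val < b, p' i j := by
    have h := hblock (i.val + 1) b
    rw [sum_val_lt_succ, sum_val_lt_succ, hblock] at h
    exact Nat.add_left_cancel h
  ext i j
  have h := hrowblock i (j.val + 1)
  rw [sum_val_lt_succ, sum_val_lt_succ, hrowblock] at h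
  exact Nat.add_left_cancel h

theorem sum_fin_eq_add {N n k : ℕ} (hN : N = n + k) (v : Fin N → ℕ) :
    ∑ i, v i = ∑ j : Fin n, v ⟨j, by omega⟩ + ∑ i : Fin k, v ⟨n + i, by omega⟩ := by
  subst hN
  exact Fin.sum_univ_add v

theorem sum_tsub_add_sum {n t : ℕ} {c : Fin n → ℕ} (hc : ∀ j, c j ≤ t) :
    ∑ j, (t - c j) + ∑ j, c j = n * t := by
  rw [← Finset.sum_add_distrib, Finset.sum_congr rfl fun j _ => Nat.sub_add_cancel (hc j)]
  simp

theorem stmt_18 (m n q : ℕ) (hm : 0 < m) (hn : 0 < n) (hq : 0 < q)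
    (f : {p : Fin m → Fin n → ℕ // IsStaircase p ∧ ∀ j : Fin n, ∑ i, p i j < q}
        → (Fin (m + n - 1) → ℕ))
    (hf : ∀ p (k : Fin (m + n - 1)),
      (∀ h : (k : ℕ) < n, f p k = (q - 1) - ∑ i, p.1 i ⟨(k : ℕ), h⟩) ∧
      (∀ _ : ¬ (k : ℕ) < n,
        f p k = ∑ j, p.1 ⟨(k : ℕ) - n + 1, by have := k.isLt; omega⟩ j)) :
    Function.Injective f ∧
      Set.range f = {v : Fin (m + n - 1) → ℕ |
        (∑ i, v i) ≤ n * (q - 1) ∧ ∀ i : Fin (m + n - 1), (i : ℕ) < n → v i < q} := by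
  obtain ⟨k, rfl⟩ : ∃ k, m = k + 1 := ⟨m - 1, by omega⟩
  have hN : k + 1 + n - 1 = n + k := by omega
  have hfcol (p) (j : Fin n) : f p ⟨j, by omega⟩ = (q - 1) - ∑ i, p.1 i j :=
    (hf p ⟨j, by omega⟩).1 j.isLt
  have hfrow (p) (i : Fin k) : f p ⟨n + i, by omega⟩ = ∑ j, p.1 i.succ j := by
    rw [(hf p ⟨n + i, by omega⟩).2 (by simp)]
    congr! 3
    simp
  have hle (p : {p : Fin (k + 1) → Fin n → ℕ //
      IsStaircase p ∧ ∀ j : Fin n, ∑ i, p i j < q}) (j : Fin n) : ∑ i, p.1 i j ≤ q - 1 :=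
    Nat.le_sub_one_of_lt (p.2.2 j)
  have htotal (p : Fin (k + 1) → Fin n → ℕ) :
      ∑ j, p 0 j + ∑ i : Fin k, ∑ j, p i.succ j = ∑ j, ∑ i, p i j := by
    rw [Finset.sum_comm (f := fun j i => p i j), Fin.sum_univ_succ]
  refine ⟨fun p p' h => ?_, Set.ext fun v => ⟨?_, ?_⟩⟩
  · have hcol (j : Fin n) : ∑ i, p.1 i j = ∑ i, p'.1 i j := by
      have h1 := hfcol p j
      rw [h, hfcol p' j] at h1
      have h2 := hle p j
      have h3 := hle p' j
      omega
    have hrow (i : Fin k) : ∑ j, p.1 i.succ j = ∑ j, p'.1 i.succ j := by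
      rw [← hfrow, ← hfrow, h]
    refine Subtype.ext (p.2.1.eq_of_sums_eq p'.2.1 (Fin.cases ?_ hrow) hcol)
    have h1 := htotal p.1
    simp only [hrow, hcol, ← htotal p'.1] at h1
    exact Nat.add_right_cancel h1
  · rintro ⟨p, rfl⟩
    refine ⟨?_, fun i hi => ?_⟩
    · rw [sum_fin_eq_add hN]
      simp only [hfcol, hfrow]
      have h1 := htotal p.1
      have h2 := sum_tsub_add_sum (hle p)
      omega
    · rw [hfcol p ⟨i, hi⟩]
      omega
  · rintro ⟨hsum, hlt⟩
    have hvle (j : Fin n) : v ⟨j, by omega⟩ ≤ q - 1 := Nat.le_sub_one_of_lt (hlt _ j.isLt)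
    have hsplit := sum_fin_eq_add hN v
    obtain ⟨p, hp, hrow, hcol⟩ := exists_isStaircase
      (Fin.cons (n * (q - 1) - ∑ i, v i) fun i : Fin k => v ⟨n + i, by omega⟩ : Fin (k + 1) → ℕ)
      (fun j : Fin n => (q - 1) - v ⟨j, by omega⟩) (by
        rw [Fin.sum_univ_succ]
        simp only [Fin.cons_zero, Fin.cons_succ]
        have h := sum_tsub_add_sum hvle
        omega)
    refine ⟨⟨p, hp, fun j => by rw [hcol]; omega⟩, funext fun i => ?_⟩
    by_cases hi : i.val < n
    · rw [hfcol _ ⟨i, hi⟩]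
      simp only [hcol]
      exact Nat.sub_sub_self (hvle ⟨i, hi⟩)
    · obtain ⟨a, ha⟩ : ∃ a : Fin k, i = ⟨n + a, by omega⟩ :=
        ⟨⟨i - n, by omega⟩, Fin.ext (by simp only; omega)⟩
      rw [ha, hfrow]
      simp only [hrow, Fin.cons_succ]
end

section
/- Let $n$ and $q$ be positive integers. The number of staircase $2 \times n$ matrices $(p_{i,j})$ of non-negative integers such that either both row sums are strictly smaller than $q$ or all $n$ column sums are strictly smaller than $q$ equals $\dfrac{n q^{n+1} - (n-2) q^{n}}{2} + n\binom{q+n-1}{n+1}$. -/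
theorem isStaircase_two_iff {n : ℕ} {p : Fin 2 → Fin n → ℕ} :
    IsStaircase p ↔ ∀ j j' : Fin n, 0 < p 1 j → j < j' → p 0 j' = 0 := by
  constructor
  · exact fun h j j' hj hjj' => h 1 0 j j' hj (by decide) hjj'
  · intro h i i' j j' hj hi hjj'
    obtain ⟨rfl, rfl⟩ : i = 1 ∧ i' = 0 := by omega
    exact h j j' hj hjj'

/-- The column sums of a `2 × n` matrix together with the sum of its top row. -/
def columnSumsAndTopSum {n : ℕ} (p : Fin 2 → Fin n → ℕ) : (Fin n → ℕ) × ℕ :=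
  (fun j => p 0 j + p 1 j, ∑ j, p 0 j)

theorem top_le_top_of_isStaircase {n : ℕ} {p p' : Fin 2 → Fin n → ℕ}
    (hp : IsStaircase p) (hp' : IsStaircase p')
    (hcol : ∀ j, p 0 j + p 1 j = p' 0 j + p' 1 j) (htop : ∑ j, p 0 j = ∑ j, p' 0 j)
    (j : Fin n) : p' 0 j ≤ p 0 j := by
  rw [isStaircase_two_iff] at hp hp'
  by_contra! hlt
  refine (Finset.sum_lt_sum (fun i _ => ?_) ⟨j, Finset.mem_univ j, hlt⟩).ne htop
  have hj := hcol j
  have hi := hcol i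
  rcases lt_trichotomy i j with h | rfl | h
  · have : p' 1 i = 0 := by
      by_contra h0
      have := hp' i j (by omega) h
      omega
    omega
  · exact hlt.le
  · have := hp j i (by omega) h
    omega

theorem injOn_columnSumsAndTopSum (n : ℕ) :
    Set.InjOn (columnSumsAndTopSum (n := n)) {p | IsStaircase p} := by
  intro p hp p' hp' h
  simp only [columnSumsAndTopSum, Prod.mk.injEq, funext_iff] at h
  obtain ⟨hcol, htop⟩ := h
  have h0 (j : Fin n) : p 0 j = p' 0 j := le_antisymm
    (top_le_top_of_isStaircase hp' hp (fun j => (hcol j).symm) htop.symm j)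
    (top_le_top_of_isStaircase hp hp' hcol htop j)
  funext i j
  have := hcol j
  have := h0 j
  fin_cases i
  · exact h0 j
  · change p 1 j = p' 1 j
    omega

theorem exists_isStaircase_columnSumsAndTopSum {n : ℕ} {c : Fin n → ℕ} {r : ℕ}
    (hr : r ≤ ∑ j, c j) : ∃ p, IsStaircase p ∧ columnSumsAndTopSum p = (c, r) := by
  let c' : ℕ → ℕ := fun k => if h : k < n then c ⟨k, h⟩ else 0
  have hc' (j : Fin n) : c' j = c j := by simp [c']
  let P : ℕ → ℕ := fun k => ∑ i ∈ Finset.range k, c' i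
  have hP : Monotone P := fun a b hab =>
    Finset.sum_le_sum_of_subset (Finset.range_mono hab)
  have hsucc (j : Fin n) : P (j + 1) = P j + c j := by
    rw [← hc']; exact Finset.sum_range_succ _ _
  have hPn : P n = ∑ j, c j := by
    simp only [P, ← Fin.sum_univ_eq_sum_range, hc']
  let t : Fin n → ℕ := fun j => min r (P (j + 1)) - min r (P j)
  have ht (j : Fin n) : t j ≤ c j := by
    have := hsucc j
    simp only [t]
    omega
  refine ⟨![t, fun j => c j - t j], isStaircase_two_iff.2 fun j j' hj hjj' => ?_, ?_⟩
  · have h1 : P (j + 1) ≤ P j' := hP hjj'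
    have h2 := hsucc j
    have h3 := hsucc j'
    simp only [Matrix.cons_val_one, Matrix.cons_val_zero, t] at hj ⊢
    omega
  · have hmono : Monotone fun k => min r (P k) := fun a b hab => min_le_min_left r (hP hab)
    have hsum : ∑ j, t j = r := by
      rw [Fin.sum_univ_eq_sum_range (fun k => min r (P (k + 1)) - min r (P k)),
        Finset.sum_range_tsub hmono, hPn]
      simp [P, hr]
    simp only [columnSumsAndTopSum, Matrix.cons_val_one, Matrix.cons_val_zero, hsum]
    congr 1
    funext j
    have := ht j
    omega

theorem two_mul_sum_piFinset_range (n q : ℕ) :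
    2 * ∑ c ∈ Fintype.piFinset fun _ : Fin n => Finset.range q, ∑ j, c j
      = n * (q - 1) * q ^ n := by
  rw [two_mul]
  have hrev : ∑ c ∈ Fintype.piFinset fun _ : Fin n => Finset.range q, ∑ j, c j =
      ∑ c ∈ Fintype.piFinset fun _ : Fin n => Finset.range q, ∑ j, (q - 1 - c j) := by
    refine Finset.sum_bij' (fun c _ j => q - 1 - c j) (fun c _ j => q - 1 - c j) ?_ ?_ ?_ ?_ ?_
    all_goals
      intro c hc
      simp only [Fintype.mem_piFinset, Finset.mem_range] at hc ⊢
    · intro j; have := hc j; omega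
    · intro j; have := hc j; omega
    · funext j; exact Nat.sub_sub_self (Nat.le_sub_one_of_lt (hc j))
    · funext j; exact Nat.sub_sub_self (Nat.le_sub_one_of_lt (hc j))
    · exact Finset.sum_congr rfl fun j _ =>
        (Nat.sub_sub_self (Nat.le_sub_one_of_lt (hc j))).symm
  nth_rewrite 2 [hrev]
  rw [← Finset.sum_add_distrib]
  have hconst : ∀ c ∈ Fintype.piFinset fun _ : Fin n => Finset.range q,
      ∑ j, c j + ∑ j, (q - 1 - c j) = n * (q - 1) := by
    intro c hc
    simp only [Fintype.mem_piFinset, Finset.mem_range] at hc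
    rw [← Finset.sum_add_distrib, Finset.sum_congr rfl (g := fun _ => q - 1)]
    · simp
    · intro j _; have := hc j; omega
  rw [Finset.sum_congr rfl hconst]
  simp [mul_comm]

theorem exists_finset_columns_lt (n q : ℕ) (hq : 0 < q) :
    ∃ B : Finset ((Fin n → ℕ) × ℕ),
      (∀ x, x ∈ B ↔ x.2 ≤ ∑ j, x.1 j ∧ ∀ j, x.1 j < q) ∧
      (B.card : ℚ) = ((n : ℚ) * (q : ℚ) ^ (n + 1) - ((n : ℚ) - 2) * (q : ℚ) ^ n) / 2 := by
  refine ⟨((Fintype.piFinset fun _ : Fin n => Finset.range q).sigma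
    fun c => Finset.range (∑ j, c j + 1)).map (Equiv.sigmaEquivProd _ _).toEmbedding, ?_, ?_⟩
  · rintro ⟨c, r⟩
    simp [Finset.mem_map_equiv, and_comm]
  · have h := congrArg (Nat.cast (R := ℚ)) (two_mul_sum_piFinset_range n q)
    rw [Finset.card_map, Finset.card_sigma]
    simp only [Finset.card_range, Finset.sum_add_distrib, Finset.sum_const,
      Fintype.card_piFinset_const, smul_eq_mul, mul_one]
    push_cast [Nat.cast_sub (Nat.one_le_iff_ne_zero.2 hq.ne')] at h ⊢
    linear_combination h / 2

theorem exists_finset_rows_lt_column_ge {n q : ℕ} (hq : 0 < q) (j : Fin n) :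
    ∃ D : Finset ((Fin n → ℕ) × ℕ),
      (∀ x, x ∈ D ↔ x.2 ≤ ∑ j, x.1 j ∧ x.2 < q ∧ ∑ j, x.1 j < x.2 + q ∧ q ≤ x.1 j) ∧
      D.card = (q + n - 1).choose (n + 1) := by
  have hsplit (c : Fin n → ℕ) : ∑ i, c i = c j + ∑ i ∈ Finset.univ.erase j, c i :=
    (Finset.add_sum_erase _ _ (Finset.mem_univ j)).symm
  obtain rfl | hq2 : q = 1 ∨ 2 ≤ q := by omega
  · refine ⟨∅, fun x => ?_, by simp⟩
    have := hsplit x.1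
    simp only [Finset.notMem_empty, false_iff]
    omega
  let f : (Option (Option (Fin n)) → ℕ) → (Fin n → ℕ) × ℕ := fun g =>
    (Function.update (fun i => g (some (some i))) j (q + g none), q - 1 - g (some (some j)))
  have herase (g : Fin n → ℕ) (a : ℕ) : ∑ i ∈ Finset.univ.erase j, Function.update g j a i =
      ∑ i ∈ Finset.univ.erase j, g i :=
    Finset.sum_congr rfl fun i hi => Function.update_of_ne (Finset.ne_of_mem_erase hi) _ _
  have hmem (g : Option (Option (Fin n)) → ℕ) :
      g ∈ Finset.piAntidiag Finset.univ (q - 2) ↔ g none + (g (some none) +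
        (g (some (some j)) + ∑ i ∈ Finset.univ.erase j, g (some (some i)))) = q - 2 := by
    simp [Fintype.sum_option, hsplit fun i => g (some (some i))]
  refine ⟨(Finset.piAntidiag Finset.univ (q - 2)).image f, ?_, ?_⟩
  · rintro ⟨c, r⟩
    simp only [Finset.mem_image, hmem]
    constructor
    · rintro ⟨g, hg, h⟩
      simp only [f, Prod.mk.injEq] at h
      obtain ⟨rfl, rfl⟩ := h
      simp only [hsplit, herase, Function.update_self]
      omega
    · rintro ⟨h1, h2, h3, h4⟩
      simp only [hsplit] at h1 h2 h3 h4
      let g : Option (Option (Fin n)) → ℕ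
        | none => c j - q
        | some none => q + r - 1 - ∑ i, c i
        | some (some i) => Function.update c j (q - 1 - r) i
      refine ⟨g, ?_, ?_⟩
      · simp only [g, herase, Function.update_self, hsplit c]
        omega
      · simp only [f, g, Function.update_self, Prod.mk.injEq]
        refine ⟨?_, by omega⟩
        rw [Nat.add_sub_cancel' h4]
        simp
  · rw [Finset.card_image_of_injOn]
    · rw [← Finset.map_sym_eq_piAntidiag, Finset.card_map, Finset.sym_univ, Finset.card_univ,
        Sym.card_sym_eq_choose, Nat.choose_symm_of_eq_add (n := q + n - 1) (a := n + 1) (b := q - 2)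
          (by omega)]
      congr 1
      simp only [Fintype.card_option, Fintype.card_fin]
      omega
    · intro g hg g' hg' h
      rw [Finset.mem_coe, hmem] at hg hg'
      simp only [f, Prod.mk.injEq] at h
      obtain ⟨h1, h2⟩ := h
      have hj := congrFun h1 j
      simp only [Function.update_self] at hj
      have hi (i : Fin n) (hne : i ≠ j) : g (some (some i)) = g' (some (some i)) := by
        simpa [hne] using congrFun h1 i
      have hs : ∑ i ∈ Finset.univ.erase j, g (some (some i)) =
          ∑ i ∈ Finset.univ.erase j, g' (some (some i)) :=
        Finset.sum_congr rfl fun i h => hi i (Finset.ne_of_mem_erase h)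
      funext k
      rcases k with _ | _ | i
      · omega
      · omega
      · rcases eq_or_ne i j with rfl | hne
        · omega
        · exact hi i hne

theorem stmt_19 (n q : ℕ) (hn : 0 < n) (hq : 0 < q) :
    ((Set.ncard {p : Fin 2 → Fin n → ℕ | IsStaircase p ∧
        ((∀ i : Fin 2, ∑ j, p i j < q) ∨ (∀ j : Fin n, ∑ i, p i j < q))} : ℕ) : ℚ)
      = ((n : ℚ) * (q : ℚ) ^ (n + 1) - ((n : ℚ) - 2) * (q : ℚ) ^ n) / 2
        + (n : ℚ) * ((q + n - 1).choose (n + 1) : ℚ) := by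
  obtain ⟨B, hB, hBcard⟩ := exists_finset_columns_lt n q hq
  choose D hD hDcard using exists_finset_rows_lt_column_ge (n := n) hq
  have himage : columnSumsAndTopSum '' {p : Fin 2 → Fin n → ℕ | IsStaircase p ∧
      ((∀ i : Fin 2, ∑ j, p i j < q) ∨ (∀ j : Fin n, ∑ i, p i j < q))} =
      ↑(B ∪ Finset.univ.biUnion D) := by
    have hiff (p : Fin 2 → Fin n → ℕ) :
        columnSumsAndTopSum p ∈ B ∪ Finset.univ.biUnion D ↔
          (∀ i : Fin 2, ∑ j, p i j < q) ∨ (∀ j : Fin n, ∑ i, p i j < q) := by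
      simp only [Finset.mem_union, Finset.mem_biUnion, Finset.mem_univ, true_and, hB, hD,
        columnSumsAndTopSum, Finset.sum_add_distrib, Fin.forall_fin_two, Fin.sum_univ_two]
      by_cases h : ∀ j, p 0 j + p 1 j < q
      · simp [h]
      · have h' := h
        push Not at h'
        obtain ⟨j, hj⟩ := h'
        simp only [h, and_false, or_false, false_or]
        constructor
        · rintro ⟨-, -, h1, h2, -⟩
          omega
        · exact fun _ => ⟨j, by omega⟩
    ext x
    constructor
    · rintro ⟨p, ⟨-, h⟩, rfl⟩
      exact (hiff p).2 h
    · intro hx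
      have hle : x.2 ≤ ∑ j, x.1 j := by
        simp only [Finset.coe_union, Set.mem_union, Finset.mem_coe, Finset.mem_biUnion, hB, hD] at hx
        grind
      obtain ⟨p, hp, hpx⟩ := exists_isStaircase_columnSumsAndTopSum hle
      exact ⟨p, ⟨hp, (hiff p).1 (hpx ▸ hx)⟩, hpx⟩
  rw [← Set.InjOn.ncard_image ((injOn_columnSumsAndTopSum n).mono fun p hp => hp.1), himage,
    Set.ncard_coe_finset, Finset.card_union_of_disjoint, Finset.card_biUnion]
  · simp [hBcard, hDcard]
  · intro i _ j _ hij
    refine Finset.disjoint_left.2 fun x hi hj => ?_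
    rw [hD] at hi hj
    have := Finset.add_le_sum (f := x.1) (s := Finset.univ) (fun _ _ => Nat.zero_le _)
      (Finset.mem_univ i) (Finset.mem_univ j) hij
    omega
  · refine Finset.disjoint_left.2 fun x hx hx' => ?_
    simp only [Finset.mem_biUnion, hD, hB] at hx hx'
    obtain ⟨j, -, hj⟩ := hx'
    have := hx.2 j
    omega
end
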